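/- arXiv:math/0111026 — 2 statements merged into one kernel-verified Lean document; each statement's English description precedes it below -/
import Mathlib

section
/- The assignment F(â) := (S(a*))^ well-defines a map F : Â → Â (using injectivity of a ↦ â) which is conjugate-linear, involutive (F(F(â)) = â for all a ∈ A), and antimultiplicative: whenever a, b, c ∈ A satisfy â · b̂ = ĉ (convolution), one has (S(b*))^ · (S(a*))^ = (S(c*))^. (Lemma 2.3.) -/
open scoped TensorProduct ComplexOrder

noncomputable section

/-- Right slice map `(id ⊗ φ) : M ⊗ A → M`. -/
def rslice {A M : Type*} [AddCommGroup A] [Module ℂ A] [AddCommGroup M] [Module ℂ M]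
    (φ : A →ₗ[ℂ] ℂ) : M ⊗[ℂ] A →ₗ[ℂ] M :=
  (TensorProduct.rid ℂ M).toLinearMap ∘ₗ TensorProduct.map LinearMap.id φ

/-- Left slice map `(φ ⊗ id) : A ⊗ M → M`. -/
def lslice {A M : Type*} [AddCommGroup A] [Module ℂ A] [AddCommGroup M] [Module ℂ M]
    (φ : A →ₗ[ℂ] ℂ) : A ⊗[ℂ] M →ₗ[ℂ] M :=
  (TensorProduct.lid ℂ M).toLinearMap ∘ₗ TensorProduct.map φ LinearMap.id

/-- The pairing `(ω ⊗ η) : A ⊗ A → ℂ`. -/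
def pair {A : Type*} [AddCommGroup A] [Module ℂ A] (ω η : A →ₗ[ℂ] ℂ) :
    A ⊗[ℂ] A →ₗ[ℂ] ℂ :=
  LinearMap.mul' ℂ ℂ ∘ₗ TensorProduct.map ω η

/-- Convolution product of linear functionals: `ω₁·ω₂ = (ω₁ ⊗ ω₂) ∘ Δ`. -/
def conv {A : Type*} [Ring A] [Algebra ℂ A] (Δ : A →ₐ[ℂ] A ⊗[ℂ] A)
    (ω η : A →ₗ[ℂ] ℂ) : A →ₗ[ℂ] ℂ :=
  pair ω η ∘ₗ Δ.toLinearMap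

/-- The conjugate dual functional `x ↦ conj (ω (x*))`. -/
def conjdual {A : Type*} [Ring A] [Algebra ℂ A] [StarRing A] [StarModule ℂ A]
    (ω : A →ₗ[ℂ] ℂ) : A →ₗ[ℂ] ℂ where
  toFun x := starRingEnd ℂ (ω (star x))
  map_add' x y := by simp
  map_smul' c x := by simp [star_smul, smul_eq_mul, map_mul]

/-- A (unital) algebraic quantum group: a unital Hopf ∗-algebra over ℂ with a
positive faithful left Haar integral, together with the associated modular
data `ρ`, `δ`, `μ`. -/
structure AQG (A : Type*) [Ring A] [Algebra ℂ A] [StarRing A] [StarModule ℂ A] where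
  Δ : A →ₐ[ℂ] A ⊗[ℂ] A
  ε : A →ₐ[ℂ] ℂ
  S : A →ₗ[ℂ] A
  Sinv : A →ₗ[ℂ] A
  φ : A →ₗ[ℂ] ℂ
  ρ : A →ₗ[ℂ] A
  ρinv : A →ₗ[ℂ] A
  δ : A
  δinv : A
  μ : ℂ
  /-- `Δ` is a ∗-homomorphism (expressed by composing with functionals, since
  they separate points of `A ⊗ A`). -/
  Δ_star : ∀ (f g : A →ₗ[ℂ] ℂ) (a : A),
    pair f g (Δ (star a)) = starRingEnd ℂ (pair (conjdual f) (conjdual g) (Δ a))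
  ε_star : ∀ a, ε (star a) = starRingEnd ℂ (ε a)
  coassoc : ∀ a, TensorProduct.assoc ℂ A A A
      (TensorProduct.map Δ.toLinearMap LinearMap.id (Δ a)) =
      TensorProduct.map LinearMap.id Δ.toLinearMap (Δ a)
  counit_left : ∀ a, lslice ε.toLinearMap (Δ a) = a
  counit_right : ∀ a, rslice ε.toLinearMap (Δ a) = a
  S_leftinv : Function.LeftInverse Sinv S
  S_rightinv : Function.RightInverse Sinv S
  S_antimul : ∀ a b, S (a * b) = S b * S a
  S_one : S 1 = 1
  antipode_left : ∀ a, LinearMap.mul' ℂ A (TensorProduct.map S LinearMap.id (Δ a)) = ε a • 1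
  antipode_right : ∀ a, LinearMap.mul' ℂ A (TensorProduct.map LinearMap.id S (Δ a)) = ε a • 1
  S_star_S : ∀ a, S (star (S (star a))) = a
  /-- positivity of the Haar functional -/
  φ_pos : ∀ a, 0 ≤ φ (star a * a)
  φ_faithful : ∀ a, φ (star a * a) = 0 → a = 0
  /-- left invariance: `(id ⊗ φ)(Δ a) = φ(a)·1` -/
  φ_left_inv : ∀ a, rslice φ (Δ a) = φ a • (1 : A)
  /-- strong left invariance -/
  φ_strong : ∀ a b, rslice φ ((1 ⊗ₜ[ℂ] a) * Δ b) = S (rslice φ (Δ a * (1 ⊗ₜ[ℂ] b)))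
  ρ_mul : ∀ a b, ρ (a * b) = ρ a * ρ b
  ρ_leftinv : Function.LeftInverse ρinv ρ
  ρ_rightinv : Function.RightInverse ρinv ρ
  φ_ρ : ∀ a b, φ (a * b) = φ (b * ρ a)
  δ_star : star δ = δ
  δ_mul_δinv : δ * δinv = 1
  δinv_mul_δ : δinv * δ = 1
  Δ_δ : Δ δ = δ ⊗ₜ[ℂ] δ
  ε_δ : ε δ = 1
  S_δ : S δ = δinv
  μ_norm : ‖μ‖ = 1
  φ_S : ∀ a, φ (S a) = φ (a * δ)
  φ_δ : ∀ a, φ (a * δ) = μ * φ (δ * a)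

namespace AQG

variable {A : Type*} [Ring A] [Algebra ℂ A] [StarRing A] [StarModule ℂ A] (G : AQG A)

/-- `â : c ↦ φ(c a)`. -/
def hat (a : A) : A →ₗ[ℂ] ℂ := G.φ ∘ₗ LinearMap.mulRight ℂ a

/-- Involution on functionals: `ω*(x) = conj (ω (S(x)*))`. -/
def inv' (ω : A →ₗ[ℂ] ℂ) : A →ₗ[ℂ] ℂ := conjdual ω ∘ₗ G.S

end AQG


namespace HopfAlgebra

open Coalgebra WithConv

variable {R C : Type*} [CommSemiring R] [Semiring C] [HopfAlgebra R C]

/-- The antipode of a Hopf algebra reverses the comultiplication. -/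
theorem comul_antipode_apply (c : C) :
    comul (R := R) (antipode R c) =
      TensorProduct.map (antipode R) (antipode R) (TensorProduct.comm R C C (comul c)) := by
  let i₁ : C →ₐ[R] C ⊗[R] C := Algebra.TensorProduct.includeLeft
  let i₂ : C →ₐ[R] C ⊗[R] C := Algebra.TensorProduct.includeRight
  let F : WithConv (C →ₗ[R] C ⊗[R] C) := toConv (i₂.toLinearMap ∘ₗ antipode R) *
    toConv (i₁.toLinearMap ∘ₗ antipode R)
  have cancel (i : C →ₐ[R] C ⊗[R] C) :
      toConv (i.toLinearMap ∘ₗ antipode R) * toConv i.toLinearMap = 1 := by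
    have h := LinearMap.algHom_comp_convMul_distrib i (toConv (antipode R (A := C)))
      (toConv LinearMap.id)
    rw [LinearMap.antipode_mul_id] at h
    apply ofConv_injective
    simp only [LinearMap.comp_id] at h
    rw [← h]
    ext x
    simp [LinearMap.convOne_def]
  have hcomul : toConv (comul (R := R) (A := C)) =
      toConv i₁.toLinearMap * toConv i₂.toLinearMap := by
    ext x
    rw [(ℛ R x).convMul_apply]
    simp [i₁, i₂, (ℛ R x).eq]
  have hleft : F * toConv (comul (R := R) (A := C)) = 1 := by
    rw [hcomul, mul_assoc, ← mul_assoc (toConv (i₁.toLinearMap ∘ₗ antipode R)), cancel, one_mul,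
      cancel]
  have hc := congrArg (fun f ↦ f c) (left_inv_eq_right_inv hleft LinearMap.comul_right_inv)
  change (F : WithConv (C →ₗ[R] C ⊗[R] C)) c = comul (antipode R c) at hc
  rw [(ℛ R c).convMul_apply] at hc
  rw [← hc, ← (ℛ R c).eq]
  simp [i₁, i₂]

end HopfAlgebra

section Slices

variable {A : Type*} [Ring A] [Algebra ℂ A]

theorem apply_lslice (f g : A →ₗ[ℂ] ℂ) (t : A ⊗[ℂ] A) : g (lslice f t) = pair f g t := by
  induction t with
  | zero => simp
  | add s t hs ht => simp [hs, ht]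
  | tmul x y => simp [lslice, pair]

theorem apply_rslice (f g : A →ₗ[ℂ] ℂ) (t : A ⊗[ℂ] A) : f (rslice g t) = pair f g t := by
  induction t with
  | zero => simp
  | add s t hs ht => simp [hs, ht]
  | tmul x y => simp [rslice, pair, mul_comm]

theorem rslice_mul_one_tmul (f : A →ₗ[ℂ] ℂ) (b : A) (t : A ⊗[ℂ] A) :
    rslice f (t * (1 ⊗ₜ[ℂ] b)) = rslice (f ∘ₗ LinearMap.mulRight ℂ b) t := by
  induction t with
  | zero => simp
  | add s t hs ht => simp [add_mul, hs, ht]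
  | tmul x y => simp [rslice]

theorem rslice_one_tmul_mul (f : A →ₗ[ℂ] ℂ) (b : A) (t : A ⊗[ℂ] A) :
    rslice f ((1 ⊗ₜ[ℂ] b) * t) = rslice (f ∘ₗ LinearMap.mulLeft ℂ b) t := by
  induction t with
  | zero => simp
  | add s t hs ht => simp [mul_add, hs, ht]
  | tmul x y => simp [rslice]

theorem lslice_map_comm (f : A →ₗ[ℂ] ℂ) (S : A →ₗ[ℂ] A) (t : A ⊗[ℂ] A) :
    lslice f (TensorProduct.map S S (TensorProduct.comm ℂ A A t)) = S (rslice (f ∘ₗ S) t) := by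
  induction t with
  | zero => simp
  | add s t hs ht => simp [hs, ht]
  | tmul x y => simp [lslice, rslice]

theorem rslice_map_comm (f : A →ₗ[ℂ] ℂ) (S : A →ₗ[ℂ] A) (t : A ⊗[ℂ] A) :
    rslice f (TensorProduct.map S S (TensorProduct.comm ℂ A A t)) = S (lslice (f ∘ₗ S) t) := by
  induction t with
  | zero => simp
  | add s t hs ht => simp [hs, ht]
  | tmul x y => simp [lslice, rslice]

end Slices

namespace AQG

variable {A : Type*} [Ring A] [Algebra ℂ A] [StarRing A] [StarModule ℂ A] (G : AQG A)

/-- The Hopf algebra underlying an algebraic quantum group. -/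
@[reducible]
def toHopfAlgebra : HopfAlgebra ℂ A where
  __ := Bialgebra.ofAlgHom G.Δ G.ε
    (by
      ext a
      exact G.coassoc a)
    (by
      ext a
      apply (TensorProduct.lid ℂ A).injective
      exact (G.counit_left a).trans (by simp))
    (by
      ext a
      apply (TensorProduct.rid ℂ A).injective
      exact (G.counit_right a).trans (by simp))
  antipode := G.S
  mul_antipode_rTensor_comul := by
    ext a
    exact (G.antipode_left a).trans (Algebra.algebraMap_eq_smul_one _).symm
  mul_antipode_lTensor_comul := by
    ext a
    exact (G.antipode_right a).trans (Algebra.algebraMap_eq_smul_one _).symm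

theorem Δ_S (a : A) :
    G.Δ (G.S a) = TensorProduct.map G.S G.S (TensorProduct.comm ℂ A A (G.Δ a)) :=
  letI := G.toHopfAlgebra
  HopfAlgebra.comul_antipode_apply (R := ℂ) a

theorem hat_apply (a x : A) : G.hat a x = G.φ (x * a) := rfl

theorem hat_injective : Function.Injective G.hat := by
  intro a b h
  refine sub_eq_zero.mp (G.φ_faithful _ ?_)
  have := LinearMap.congr_fun h (star (a - b))
  rw [hat_apply, hat_apply] at this
  rw [mul_sub, map_sub, this, sub_self]

theorem φ_star (x : A) : G.φ (star x) = starRingEnd ℂ (G.φ x) := by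
  have im_zero (a : A) : (G.φ (star a * a)).im = 0 := (Complex.nonneg_iff.mp (G.φ_pos a)).2.symm
  have h₀ := im_zero x
  have h₁ := im_zero 1
  have h₂ := im_zero (1 + x)
  have h₃ := im_zero (1 + Complex.I • x)
  simp only [star_add, star_one, star_smul, add_mul, mul_add, one_mul, mul_one, map_add,
    smul_mul_assoc, mul_smul_comm, map_smul, smul_eq_mul, Complex.add_im] at h₁ h₂ h₃
  simp at h₃
  apply Complex.ext <;> simp <;> linarith

theorem star_S_star (x : A) : star (G.S (star x)) = G.Sinv x := by
  rw [← G.S_leftinv (star (G.S (star x))), G.S_star_S]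

/-- The convolution of `â` and `b̂` is the transform of `φ(S⁻¹(b₍₁₎) a) b₍₂₎`. -/
theorem conv_hat (a b : A) :
    conv G.Δ (G.hat a) (G.hat b) = G.hat (lslice (G.hat a ∘ₗ G.Sinv) (G.Δ b)) := by
  ext x
  change pair (G.hat a) (G.hat b) (G.Δ x) =
    (G.φ ∘ₗ LinearMap.mulLeft ℂ x) (lslice (G.hat a ∘ₗ G.Sinv) (G.Δ b))
  rw [apply_lslice, ← apply_rslice, ← apply_rslice, ← rslice_one_tmul_mul, G.φ_strong,
    rslice_mul_one_tmul, LinearMap.comp_apply, G.S_leftinv]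
  rfl

theorem star_lslice_Δ (f : A →ₗ[ℂ] ℂ) (b : A) :
    star (lslice (conjdual f) (G.Δ b)) = lslice f (G.Δ (star b)) := by
  rw [← sub_eq_zero, ← Module.forall_dual_apply_eq_zero_iff ℂ]
  intro g
  rw [map_sub, sub_eq_zero, apply_lslice, G.Δ_star, ← apply_lslice]
  simp [conjdual]

theorem conv_hat_S_star (a b : A) :
    conv G.Δ (G.hat (G.S (star b))) (G.hat (G.S (star a))) =
      G.hat (G.S (star (lslice (G.hat a ∘ₗ G.Sinv) (G.Δ b)))) := by
  let k : A →ₗ[ℂ] ℂ := (G.φ ∘ₗ LinearMap.mulLeft ℂ (star a)) ∘ₗ G.S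
  have hk : conjdual k = G.hat a ∘ₗ G.Sinv := by
    ext x
    change starRingEnd ℂ (G.φ (star a * G.S (star x))) = G.φ (G.Sinv x * a)
    rw [← G.φ_star, star_mul, star_star, star_S_star]
  have hS : G.Sinv ∘ₗ G.S = LinearMap.id := LinearMap.ext G.S_leftinv
  have hhat : G.hat (G.S (star b)) = G.φ ∘ₗ LinearMap.mulRight ℂ (G.S (star b)) := rfl
  rw [conv_hat, ← hk, star_lslice_Δ, G.Δ_S, lslice_map_comm, LinearMap.comp_assoc, hS,
    LinearMap.comp_id, hhat, ← rslice_mul_one_tmul, ← G.φ_strong, rslice_one_tmul_mul, G.Δ_S,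
    rslice_map_comm]

end AQG

/-- Lemma 2.3: `F(â) = (S(a*))^` well-defines a conjugate-linear, involutive,
antimultiplicative map `F : Â → Â`. -/
theorem stmt7 {A : Type*} [Ring A] [Algebra ℂ A] [StarRing A] [StarModule ℂ A]
    (G : AQG A) :
    -- `F` is well defined
    (∀ a b : A, G.hat a = G.hat b → G.hat (G.S (star a)) = G.hat (G.S (star b))) ∧
    -- `F` is conjugate-linear
    (∀ (c : ℂ) (a b : A),
      G.hat (G.S (star (c • a + b))) =
        starRingEnd ℂ c • G.hat (G.S (star a)) + G.hat (G.S (star b))) ∧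
    -- `F` is involutive
    (∀ a : A, G.hat (G.S (star (G.S (star a)))) = G.hat a) ∧
    -- `F` is antimultiplicative
    (∀ a b c : A, conv G.Δ (G.hat a) (G.hat b) = G.hat c →
      conv G.Δ (G.hat (G.S (star b))) (G.hat (G.S (star a))) = G.hat (G.S (star c))) := by
  refine ⟨fun a b h ↦ by rw [G.hat_injective h], fun c a b ↦ ?_, fun a ↦ by rw [G.S_star_S],
    fun a b c h ↦ ?_⟩
  · ext x
    simp [AQG.hat_apply, mul_add]
  · rw [G.conv_hat_S_star, G.hat_injective ((G.conv_hat a b).symm.trans h)]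
end
end

section
/- For all a, b ∈ A: if d ∈ A satisfies d̂ = (b̂)* · â (convolution product of linear functionals on A, with ω*(x) = conj(ω(S(x)*))), then ε(d) = φ(b* a). (Equivalently ψ̂(b̂* â) = φ(b* a), the identity making (H, Λ̂), Λ̂(â) = Λ(a), a GNS pair for the dual right Haar integral ψ̂.) -/
open scoped TensorProduct ComplexOrder

noncomputable section

namespace AQG

variable {A : Type*} [Ring A] [Algebra ℂ A] [StarRing A] [StarModule ℂ A] (G : AQG A)

theorem inv'_hat_apply (b x : A) : G.inv' (G.hat b) x = G.φ (star b * G.S x) := by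
  change starRingEnd ℂ (G.φ (star (G.S x) * b)) = _
  rw [← φ_star, star_mul, star_star]

theorem pair_hat (ω : A →ₗ[ℂ] ℂ) (a : A) (t : A ⊗[ℂ] A) :
    pair ω (G.hat a) t = ω (rslice G.φ (t * (1 ⊗ₜ[ℂ] a))) := by
  induction t with
  | zero => simp
  | add s t hs ht => rw [map_add, hs, ht, add_mul, map_add, map_add]
  | tmul x y => simp [pair, hat, rslice, mul_comm]

theorem φ_mul_lslice (ω : A →ₗ[ℂ] ℂ) (c : A) (t : A ⊗[ℂ] A) :
    G.φ (c * lslice ω t) = ω (rslice G.φ ((1 ⊗ₜ[ℂ] c) * t)) := by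
  induction t with
  | zero => simp
  | add s t hs ht => rw [map_add, mul_add, map_add, hs, ht, mul_add, map_add, map_add]
  | tmul x y => simp [lslice, rslice, mul_comm]

theorem ε_lslice (ω : A →ₗ[ℂ] ℂ) (t : A ⊗[ℂ] A) :
    G.ε (lslice ω t) = ω (rslice G.ε.toLinearMap t) := by
  induction t with
  | zero => simp
  | add s t hs ht => simp only [map_add, hs, ht]
  | tmul x y => simp [lslice, rslice, mul_comm]

/-- The element representing `b̂* · â` is `(φ(b* ·) ⊗ id)(Δ a)`. -/
theorem conv_inv'_hat (a b : A) :
    conv G.Δ (G.inv' (G.hat b)) (G.hat a) =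
      G.hat (lslice (G.φ ∘ₗ LinearMap.mulLeft ℂ (star b)) (G.Δ a)) := by
  ext c
  change pair (G.inv' (G.hat b)) (G.hat a) (G.Δ c) = G.φ (c * _)
  rw [pair_hat, inv'_hat_apply, ← G.φ_strong, φ_mul_lslice]
  rfl

end AQG

/-- GNS identity for the dual right Haar integral: if `d̂ = b̂* · â` then
`ε(d) = φ(b* a)`, i.e. `ψ̂(b̂* â) = φ(b* a)`. -/
theorem stmt13 {A : Type*} [Ring A] [Algebra ℂ A] [StarRing A] [StarModule ℂ A]
    (G : AQG A) :
    ∀ a b d : A,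
      G.hat d = conv G.Δ (G.inv' (G.hat b)) (G.hat a) →
      G.ε d = G.φ (star b * a) := by
  intro a b d h
  rw [G.conv_inv'_hat] at h
  rw [G.hat_injective h, G.ε_lslice, G.counit_right]
  rfl
end
end
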